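/- arXiv:2105.08024 — 2 statements merged into one kernel-verified Lean document; each statement's English description precedes it below -/
import Mathlib

section
/- Let d and k be positive integers and let φ : {1,…,k} → ℝ^d be vectors with ‖φ_i‖₂ ≤ 1 for all i. For 0 ≤ j ≤ k define the d×d matrix Λ_j = I + Σ_{i=1}^{j} φ_i φ_iᵀ (so Λ_0 = I). Then each Λ_j is positive definite (hence invertible), and Σ_{i=1}^{k} φ_iᵀ (Λ_{i-1})⁻¹ φ_i ≤ 2 · log( det(Λ_k) ). -/
open Matrix BigOperators

/-- The regularized Gram matrix `Λ_j = I + ∑_{i=1}^{j} φ_i φ_iᵀ`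
(here indexed so that `φ i` for `i : Fin k` is the `(i+1)`-st vector). -/
noncomputable def gramMat (d k : ℕ) (φ : Fin k → Fin d → ℝ) (j : ℕ) :
    Matrix (Fin d) (Fin d) ℝ :=
  1 + ∑ i : Fin k, if (i : ℕ) < j then vecMulVec (φ i) (φ i) else 0

theorem gram_psd (d k : ℕ) (φ : Fin k → Fin d → ℝ) (j : ℕ) :
    (∑ i : Fin k, if (i : ℕ) < j then vecMulVec (φ i) (φ i) else 0).PosSemidef := by
  refine Matrix.posSemidef_sum _ fun i _ => ?_
  split_ifs
  · simpa using posSemidef_vecMulVec_self_star (φ i)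
  · exact PosSemidef.zero

theorem gram_posDef (d k : ℕ) (φ : Fin k → Fin d → ℝ) (j : ℕ) :
    (gramMat d k φ j).PosDef :=
  PosDef.one.add_posSemidef (gram_psd d k φ j)

theorem gram_succ (d k : ℕ) (φ : Fin k → Fin d → ℝ) (i : Fin k) :
    gramMat d k φ ((i : ℕ) + 1) = gramMat d k φ i + vecMulVec (φ i) (φ i) := by
  unfold gramMat
  rw [add_assoc]
  congr 1
  have h : vecMulVec (φ i) (φ i) =
      ∑ l : Fin k, if l = i then vecMulVec (φ l) (φ l) else 0 := by simp
  rw [h, ← Finset.sum_add_distrib]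
  refine Finset.sum_congr rfl fun l _ => ?_
  by_cases h1 : l = i
  · subst h1; simp
  · have h2 : (l : ℕ) ≠ i := fun h => h1 (Fin.ext h)
    have h3 : ((l : ℕ) < i + 1) ↔ (l : ℕ) < i := by omega
    simp [h1, h3]

theorem quad_le (d k : ℕ) (φ : Fin k → Fin d → ℝ) (j : ℕ) (v : Fin d → ℝ) :
    v ⬝ᵥ (gramMat d k φ j)⁻¹.mulVec v ≤ v ⬝ᵥ v := by
  have hu : IsUnit (gramMat d k φ j).det := (gram_posDef d k φ j).det_pos.ne'.isUnit
  obtain ⟨y, hy⟩ : ∃ y, y = (gramMat d k φ j)⁻¹.mulVec v := ⟨_, rfl⟩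
  have hv : (gramMat d k φ j).mulVec y = v := by
    rw [hy, mulVec_mulVec, mul_nonsing_inv _ hu, one_mulVec]
  rw [← hy]
  have h1 : y ⬝ᵥ y ≤ v ⬝ᵥ y := by
    have h := (gram_psd d k φ j).dotProduct_mulVec_nonneg y
    rw [dotProduct_comm v y, ← hv]
    unfold gramMat
    rw [add_mulVec, dotProduct_add, one_mulVec]
    simpa using h
  have h2 : 0 ≤ (v - y) ⬝ᵥ (v - y) := Finset.sum_nonneg fun i _ => mul_self_nonneg _
  rw [sub_dotProduct, dotProduct_sub, dotProduct_sub, dotProduct_comm y v] at h2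
  linarith

theorem gram_step (d k : ℕ) (φ : Fin k → Fin d → ℝ) (i : Fin k)
    (hφ : Real.sqrt (∑ j, (φ i j) ^ 2) ≤ 1) :
    φ i ⬝ᵥ (gramMat d k φ (i : ℕ))⁻¹.mulVec (φ i) ≤
      2 * Real.log (gramMat d k φ ((i : ℕ) + 1)).det - 2 * Real.log (gramMat d k φ i).det := by
  have hp := (gram_posDef d k φ i).det_pos
  have hdet : (gramMat d k φ ((i : ℕ) + 1)).det = (gramMat d k φ i).det *
      (1 + φ i ⬝ᵥ (gramMat d k φ (i : ℕ))⁻¹.mulVec (φ i)) := by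
    rw [gram_succ, vecMulVec_eq Unit, det_add_replicateCol_mul_replicateRow hp.ne'.isUnit]
    congr 1
    rw [Matrix.mul_assoc, ← replicateCol_mulVec, det_unique]
    simp [Matrix.mul_apply, dotProduct]
  have h1 : φ i ⬝ᵥ (gramMat d k φ (i : ℕ))⁻¹.mulVec (φ i) ≤ 1 := by
    refine (quad_le d k φ i (φ i)).trans ?_
    have := (Real.sqrt_le_iff.1 hφ).2
    simpa [dotProduct, sq] using this
  have h0 : 0 ≤ φ i ⬝ᵥ (gramMat d k φ (i : ℕ))⁻¹.mulVec (φ i) := by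
    simpa using (gram_posDef d k φ i).inv.posSemidef.dotProduct_mulVec_nonneg (φ i)
  rw [hdet]
  generalize φ i ⬝ᵥ (gramMat d k φ (i : ℕ))⁻¹.mulVec (φ i) = x at *
  have hx : 0 < 1 + x := by linarith
  rw [Real.log_mul hp.ne' hx.ne']
  have h2 := Real.one_sub_inv_le_log_of_pos hx
  have h3 : x / 2 ≤ 1 - (1 + x)⁻¹ := by
    have : 1 - (1 + x)⁻¹ = x / (1 + x) := by field_simp; ring
    rw [this]
    exact div_le_div_of_nonneg_left h0 hx (by linarith)
  linarith

/-- Elliptical potential lemma: each `Λ_j` is positive definite, and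
`∑_{i=1}^{k} φ_iᵀ (Λ_{i-1})⁻¹ φ_i ≤ 2 log det Λ_k`. -/
theorem stmt_0 (d k : ℕ) (hd : 0 < d) (hk : 0 < k)
    (φ : Fin k → Fin d → ℝ)
    (hφ : ∀ i : Fin k, Real.sqrt (∑ j, (φ i j) ^ 2) ≤ 1) :
    (∀ j : ℕ, j ≤ k → (gramMat d k φ j).PosDef) ∧
      ∑ i : Fin k, φ i ⬝ᵥ (gramMat d k φ (i : ℕ))⁻¹.mulVec (φ i)
        ≤ 2 * Real.log (gramMat d k φ k).det := by
  refine ⟨fun j _ => gram_posDef d k φ j, ?_⟩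
  refine (Finset.sum_le_sum fun i _ => gram_step d k φ i (hφ i)).trans ?_
  rw [Fin.sum_univ_eq_sum_range (fun n => 2 * Real.log (gramMat d k φ (n + 1)).det -
    2 * Real.log (gramMat d k φ n).det) k,
    Finset.sum_range_sub (fun n => 2 * Real.log (gramMat d k φ n).det)]
  simp [gramMat]
end

section
/- Let d, m be positive integers, θ* ∈ ℝ^d, and let φ_1, …, φ_m ∈ ℝ^d and y_1, …, y_m ∈ ℝ. Define Λ = I + Σ_{i=1}^{m} φ_i φ_iᵀ, let Φ be the d×m matrix whose columns are φ_1, …, φ_m, and let θ̂ = Λ⁻¹ Σ_{i=1}^{m} φ_i y_i. Suppose the residual vector e ∈ ℝ^m with entries e_i = y_i − ⟨φ_i, θ*⟩ decomposes as e = u + v + w with u, v, w ∈ ℝ^m. Then for every φ ∈ ℝ^d: | ⟨φ, θ̂⟩ − ⟨φ, θ*⟩ | ≤ ( ‖u‖₂ + ‖v‖₂ + sqrt( (Φ w)ᵀ Λ⁻¹ (Φ w) ) + ‖θ*‖₂ ) · sqrt( φᵀ Λ⁻¹ φ ). -/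
open Matrix BigOperators

/-- The regularized Gram matrix `Λ = I + ∑_{i=1}^m φ_i φ_iᵀ`. -/
noncomputable def ridgeLam (d m : ℕ) (φ : Fin m → Fin d → ℝ) :
    Matrix (Fin d) (Fin d) ℝ :=
  1 + ∑ i : Fin m, vecMulVec (φ i) (φ i)

/-- The `d × m` matrix whose columns are `φ_1, …, φ_m`. -/
def colMat (d m : ℕ) (φ : Fin m → Fin d → ℝ) : Matrix (Fin d) (Fin m) ℝ :=
  Matrix.of fun (r : Fin d) (c : Fin m) => φ c r

lemma ridge_cs {ι : Type*} [Fintype ι] (a b : ι → ℝ) :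
    |a ⬝ᵥ b| ≤ Real.sqrt (∑ i, a i ^ 2) * Real.sqrt (∑ i, b i ^ 2) := by
  rw [← Real.sqrt_mul (Finset.sum_nonneg fun i _ => sq_nonneg (a i))]
  apply Real.abs_le_sqrt
  exact Finset.sum_mul_sq_le_sq_mul_sq _ _ _

lemma ridgeLam_eq (d m : ℕ) (φ : Fin m → Fin d → ℝ) :
    ridgeLam d m φ = 1 + colMat d m φ * (colMat d m φ)ᵀ := by
  unfold ridgeLam
  congr 1
  ext i j
  simp [colMat, Matrix.mul_apply, Matrix.sum_apply, vecMulVec_apply]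

lemma ridgeLam_isUnit (d m : ℕ) (φ : Fin m → Fin d → ℝ) :
    IsUnit (ridgeLam d m φ).det := by
  have h : (ridgeLam d m φ).PosDef := by
    rw [ridgeLam_eq]
    refine Matrix.PosDef.add_posSemidef Matrix.PosDef.one ?_
    simpa using Matrix.posSemidef_self_mul_conjTranspose (colMat d m φ)
  exact h.det_pos.ne'.isUnit

lemma ridgeLam_symm (d m : ℕ) (φ : Fin m → Fin d → ℝ) :
    (ridgeLam d m φ)ᵀ = ridgeLam d m φ := by
  rw [ridgeLam_eq]
  simp [Matrix.transpose_mul]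

lemma ridgeLam_form (d m : ℕ) (φ : Fin m → Fin d → ℝ) (x z : Fin d → ℝ) :
    x ⬝ᵥ (ridgeLam d m φ) *ᵥ z =
      x ⬝ᵥ z + ((colMat d m φ)ᵀ *ᵥ x) ⬝ᵥ ((colMat d m φ)ᵀ *ᵥ z) := by
  rw [ridgeLam_eq, Matrix.add_mulVec, Matrix.one_mulVec, dotProduct_add, ← Matrix.mulVec_mulVec,
    Matrix.dotProduct_mulVec x (colMat d m φ), Matrix.mulVec_transpose, Matrix.mulVec_transpose]

/-- Prediction-error bound for the ridge estimator `θ̂ = Λ⁻¹ ∑_i y_i φ_i`: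
if the residuals `e_i = y_i − ⟨φ_i, θ*⟩` decompose as `e = u + v + w`, then
`|⟨φ, θ̂⟩ − ⟨φ, θ*⟩| ≤ (‖u‖₂ + ‖v‖₂ + ‖Λ^{-1/2} Φ w‖₂ + ‖θ*‖₂) ‖Λ^{-1/2} φ‖₂`. -/
theorem stmt_8 (d m : ℕ) (hd : 0 < d) (hm : 0 < m)
    (θs : Fin d → ℝ) (φ : Fin m → Fin d → ℝ) (y : Fin m → ℝ)
    (u v w : Fin m → ℝ)
    (hdecomp : ∀ i : Fin m, y i - φ i ⬝ᵥ θs = u i + v i + w i) :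
    ∀ ψ : Fin d → ℝ,
      |ψ ⬝ᵥ (ridgeLam d m φ)⁻¹.mulVec (∑ i : Fin m, y i • φ i) - ψ ⬝ᵥ θs| ≤
        (Real.sqrt (∑ i, u i ^ 2) + Real.sqrt (∑ i, v i ^ 2)
            + Real.sqrt (((colMat d m φ).mulVec w) ⬝ᵥ
                (ridgeLam d m φ)⁻¹.mulVec ((colMat d m φ).mulVec w))
            + Real.sqrt (∑ j, θs j ^ 2))
          * Real.sqrt (ψ ⬝ᵥ (ridgeLam d m φ)⁻¹.mulVec ψ) := by
  intro ψ
  have hU := ridgeLam_isUnit d m φ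
  have hS := ridgeLam_symm d m φ
  have hF := ridgeLam_form d m φ
  have hsum : ∑ i : Fin m, y i • φ i = colMat d m φ *ᵥ y := by
    ext j
    simp [colMat, Matrix.mulVec, dotProduct, Finset.sum_apply, mul_comm]
  have hy : y = (u + v + w) + (colMat d m φ)ᵀ *ᵥ θs := by
    ext i
    have h1 : ((colMat d m φ)ᵀ *ᵥ θs) i = φ i ⬝ᵥ θs := rfl
    have h2 := hdecomp i
    simp only [Pi.add_apply, h1]
    linarith
  rw [hsum]
  generalize hA : colMat d m φ = A at *
  generalize ridgeLam d m φ = L at *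
  have hLi : ∀ z, L *ᵥ (L⁻¹ *ᵥ z) = z := fun z => by
    rw [Matrix.mulVec_mulVec, Matrix.mul_nonsing_inv _ hU, Matrix.one_mulVec]
  have hmove : ∀ z, ψ ⬝ᵥ L⁻¹ *ᵥ z = (L⁻¹ *ᵥ ψ) ⬝ᵥ z := fun z => by
    rw [Matrix.dotProduct_mulVec, ← Matrix.mulVec_transpose, Matrix.transpose_nonsing_inv, hS]
  have hq : ∀ z, z ⬝ᵥ L⁻¹ *ᵥ z =
      ∑ k, Sum.elim (L⁻¹ *ᵥ z) (Aᵀ *ᵥ (L⁻¹ *ᵥ z)) k ^ 2 := fun z => by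
    have h := hF (L⁻¹ *ᵥ z) (L⁻¹ *ᵥ z)
    rw [hLi, dotProduct_comm] at h
    rw [h]
    simp [Fintype.sum_sum_type, dotProduct, sq]
  have hψ : ∀ z, ψ ⬝ᵥ z = (L⁻¹ *ᵥ ψ) ⬝ᵥ L *ᵥ z := fun z => by
    rw [Matrix.dotProduct_mulVec, ← Matrix.mulVec_transpose, hS, hLi]
  have hAdj : ∀ z, (L⁻¹ *ᵥ ψ) ⬝ᵥ A *ᵥ z = (Aᵀ *ᵥ (L⁻¹ *ᵥ ψ)) ⬝ᵥ z := fun z => by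
    rw [Matrix.dotProduct_mulVec, Matrix.mulVec_transpose]
  have hw : |(L⁻¹ *ᵥ ψ) ⬝ᵥ A *ᵥ w| ≤
      Real.sqrt ((A *ᵥ w) ⬝ᵥ L⁻¹ *ᵥ (A *ᵥ w)) * Real.sqrt (ψ ⬝ᵥ L⁻¹ *ᵥ ψ) := by
    have h := hF (L⁻¹ *ᵥ ψ) (L⁻¹ *ᵥ (A *ᵥ w))
    rw [hLi] at h
    rw [h, hq, hq ψ, mul_comm, ← sumElim_dotProduct_sumElim]
    exact ridge_cs _ _
  have hbig : ∀ a : Fin m → ℝ, |(Aᵀ *ᵥ (L⁻¹ *ᵥ ψ)) ⬝ᵥ a| ≤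
      Real.sqrt (∑ i, a i ^ 2) * Real.sqrt (ψ ⬝ᵥ L⁻¹ *ᵥ ψ) := fun a => by
    rw [mul_comm]
    refine (ridge_cs _ _).trans (mul_le_mul_of_nonneg_right (Real.sqrt_le_sqrt ?_) (Real.sqrt_nonneg _))
    rw [hq, Fintype.sum_sum_type]
    simp only [Sum.elim_inl, Sum.elim_inr]
    exact le_add_of_nonneg_left (Finset.sum_nonneg fun i _ => sq_nonneg _)
  have hθ : |(L⁻¹ *ᵥ ψ) ⬝ᵥ θs| ≤
      Real.sqrt (∑ i, θs i ^ 2) * Real.sqrt (ψ ⬝ᵥ L⁻¹ *ᵥ ψ) := by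
    rw [mul_comm]
    refine (ridge_cs _ _).trans (mul_le_mul_of_nonneg_right (Real.sqrt_le_sqrt ?_) (Real.sqrt_nonneg _))
    rw [hq, Fintype.sum_sum_type]
    simp only [Sum.elim_inl, Sum.elim_inr]
    exact le_add_of_nonneg_right (Finset.sum_nonneg fun i _ => sq_nonneg _)
  have key : ψ ⬝ᵥ L⁻¹ *ᵥ (A *ᵥ y) - ψ ⬝ᵥ θs =
      (Aᵀ *ᵥ (L⁻¹ *ᵥ ψ)) ⬝ᵥ u + (Aᵀ *ᵥ (L⁻¹ *ᵥ ψ)) ⬝ᵥ v + (L⁻¹ *ᵥ ψ) ⬝ᵥ A *ᵥ w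
        - (L⁻¹ *ᵥ ψ) ⬝ᵥ θs := by
    rw [hmove, hψ θs, hF, hAdj, hAdj, hy]
    simp only [dotProduct_add]
    ring
  rw [key]
  have hu := abs_le.1 (hbig u)
  have hv := abs_le.1 (hbig v)
  have hw := abs_le.1 hw
  have hθ := abs_le.1 hθ
  simp only [add_mul]
  rw [abs_le]
  constructor <;> linarith [hu.1, hu.2, hv.1, hv.2, hw.1, hw.2, hθ.1, hθ.2]
end
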